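/- (Theorem 1) For every α ∈ (0,1), every finite positive integer M, and every γ ≥ 0, I_{α,M}(γ) = \bar I_{α,M}(γ), where I_{α,M}(γ) = max{ η : (γ, η) ∈ ℛ_{α,M} } is the maximal achievable relevance at Rényi entropy cost γ. -/

import Mathlib

open Real BigOperators Filter

noncomputable section

/-- Base-2 Shannon entropy of a probability vector on a finite alphabet. -/
def shEnt {I : Type} [Fintype I] (P : I → ℝ) : ℝ := -∑ i, P i * Real.logb 2 (P i)

/-- Rényi entropy of order `α` (base 2) of a probability vector. -/
def renyiEnt {I : Type} [Fintype I] (α : ℝ) (P : I → ℝ) : ℝ :=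
  (1 - α)⁻¹ * Real.logb 2 (∑ i, P i ^ α)

open Classical in
/-- Entropy of order `α`, where `α = 1` is understood as Shannon entropy. -/
def entOrd {I : Type} [Fintype I] (α : ℝ) (P : I → ℝ) : ℝ :=
  if α = 1 then shEnt P else renyiEnt α P

/-- `p` is a joint pmf on `Y × X`. -/
def IsJointPmf {Y X : Type} [Fintype Y] [Fintype X] (p : Y → X → ℝ) : Prop :=
  (∀ y x, 0 ≤ p y x) ∧ ∑ y, ∑ x, p y x = 1

/-- `q` is a channel (conditional pmf) from `X` to `W`. -/
def IsKernel {X W : Type} [Fintype X] [Fintype W] (q : X → W → ℝ) : Prop :=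
  (∀ x w, 0 ≤ q x w) ∧ ∀ x, ∑ w, q x w = 1

def margX {Y X : Type} [Fintype Y] [Fintype X] (p : Y → X → ℝ) (x : X) : ℝ := ∑ y, p y x

def margY {Y X : Type} [Fintype Y] [Fintype X] (p : Y → X → ℝ) (y : Y) : ℝ := ∑ x, p y x

/-- Marginal of `W` when `W` is generated from `X` through the channel `q`. -/
def margW {Y X W : Type} [Fintype Y] [Fintype X] [Fintype W]
    (p : Y → X → ℝ) (q : X → W → ℝ) (w : W) : ℝ := ∑ x, margX p x * q x w

/-- Joint pmf of `(Y, W)` under the Markov chain `Y - X - W`. -/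
def jointYW {Y X W : Type} [Fintype Y] [Fintype X] [Fintype W]
    (p : Y → X → ℝ) (q : X → W → ℝ) (y : Y) (w : W) : ℝ := ∑ x, p y x * q x w

/-- Joint pmf of `(X, W)`. -/
def jointXW {Y X W : Type} [Fintype Y] [Fintype X] [Fintype W]
    (p : Y → X → ℝ) (q : X → W → ℝ) (x : X) (w : W) : ℝ := margX p x * q x w

/-- Mutual information (base 2) of a joint pmf on `A × B`. -/
def mi2 {A B : Type} [Fintype A] [Fintype B] (r : A → B → ℝ) : ℝ :=
  shEnt (fun a => ∑ b, r a b) + shEnt (fun b => ∑ a, r a b)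
    - shEnt (fun ab : A × B => r ab.1 ab.2)

/-- `I(Y;W)` under the Markov chain `Y - X - W`. -/
def miYW {Y X W : Type} [Fintype Y] [Fintype X] [Fintype W]
    (p : Y → X → ℝ) (q : X → W → ℝ) : ℝ := mi2 (jointYW p q)

/-- `I(Y;X)`. -/
def miYX {Y X : Type} [Fintype Y] [Fintype X] (p : Y → X → ℝ) : ℝ := mi2 p

/-- `I(X;W)`. -/
def miXW {Y X W : Type} [Fintype Y] [Fintype X] [Fintype W]
    (p : Y → X → ℝ) (q : X → W → ℝ) : ℝ := mi2 (jointXW p q)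

/-- The bottleneck function `F_{α,M}(γ)`: maximal relevance `I(Y;W)` over channels
`P_{W|X}` with output alphabet of size (at most) `M` satisfying `H_α(W) ≤ γ`. -/
def Ffun {Y X : Type} [Fintype Y] [Fintype X] (p : Y → X → ℝ) (M : ℕ) (α γ : ℝ) : ℝ :=
  sSup {v | ∃ q : X → Fin M → ℝ, IsKernel q ∧ entOrd α (margW p q) ≤ γ ∧ v = miYW p q}

/-- Upper concave envelope on `[0,∞)` via two-point convex combinations. -/
def env (F : ℝ → ℝ) (γ : ℝ) : ℝ :=
  sSup {v | ∃ t γ₁ γ₂ : ℝ, 0 ≤ t ∧ t ≤ 1 ∧ 0 ≤ γ₁ ∧ 0 ≤ γ₂ ∧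
    t * γ₁ + (1 - t) * γ₂ = γ ∧ v = t * F γ₁ + (1 - t) * F γ₂}

/-- The information bottleneck function `\bar I_IB(r)`. -/
def IBfun {Y X : Type} [Fintype Y] [Fintype X] (p : Y → X → ℝ) (r : ℝ) : ℝ :=
  sSup {v | ∃ (m : ℕ) (q : X → Fin m → ℝ), IsKernel q ∧ miXW p q ≤ r ∧ v = miYW p q}

/-- The i.i.d. joint pmf of `(Yⁿ, Xⁿ)`. -/
def iidP {Y X : Type} [Fintype Y] [Fintype X] (p : Y → X → ℝ) (n : ℕ)
    (yn : Fin n → Y) (xn : Fin n → X) : ℝ := ∏ i, p (yn i) (xn i)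

open Classical in
/-- Joint pmf of `(Y_i, W_i)` when `Wⁿ` is produced from `Xⁿ` by the (possibly randomized)
code `Q` and `(Yⁿ, Xⁿ)` is i.i.d. with per-letter law `p`. -/
def pairYW {Y X W : Type} [Fintype Y] [Fintype X] [Fintype W]
    (p : Y → X → ℝ) (n : ℕ) (Q : (Fin n → X) → (Fin n → W) → ℝ) (i : Fin n)
    (y : Y) (w : W) : ℝ :=
  ∑ yn : Fin n → Y, ∑ xn : Fin n → X, ∑ wn : Fin n → W,
    iidP p n yn xn * Q xn wn * (if yn i = y ∧ wn i = w then 1 else 0)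

/-- Average per-letter output Rényi entropy `γ_n = (1/n) ∑ H_α(W_i)` of a code. -/
def avgRenyi {Y X W : Type} [Fintype Y] [Fintype X] [Fintype W]
    (p : Y → X → ℝ) (n : ℕ) (Q : (Fin n → X) → (Fin n → W) → ℝ) (α : ℝ) : ℝ :=
  (1 / (n : ℝ)) * ∑ i : Fin n, renyiEnt α (fun w => ∑ y, pairYW p n Q i y w)

/-- Average per-letter relevance `η_n = (1/n) ∑ I(Y_i; W_i)` of a code. -/
def avgRel {Y X W : Type} [Fintype Y] [Fintype X] [Fintype W]
    (p : Y → X → ℝ) (n : ℕ) (Q : (Fin n → X) → (Fin n → W) → ℝ) : ℝ :=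
  (1 / (n : ℝ)) * ∑ i : Fin n, mi2 (pairYW p n Q i)

/-- A Rényi entropy-relevance pair `(γ, η)` is achievable if some sequence of
(possibly randomized) codes `Φⁿ : 𝒳ⁿ → 𝒲ⁿ`, `|𝒲| ≤ M`, has
`limsup γ_n ≤ γ` and `liminf η_n ≥ η`. -/
def Achievable {Y X : Type} [Fintype Y] [Fintype X]
    (p : Y → X → ℝ) (M : ℕ) (α γ η : ℝ) : Prop :=
  ∃ Q : (n : ℕ) → (Fin n → X) → (Fin n → Fin M) → ℝ,
    (∀ n, IsKernel (Q n)) ∧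
    Filter.limsup (fun n => avgRenyi p n (Q n) α) Filter.atTop ≤ γ ∧
    η ≤ Filter.liminf (fun n => avgRel p n (Q n)) Filter.atTop

/-- The achievable Rényi entropy-relevance region: the closure of all achievable pairs. -/
def Region {Y X : Type} [Fintype Y] [Fintype X]
    (p : Y → X → ℝ) (M : ℕ) (α : ℝ) : Set (ℝ × ℝ) :=
  closure {z : ℝ × ℝ | 0 ≤ z.1 ∧ 0 ≤ z.2 ∧ Achievable p M α z.1 z.2}

/-- `I_{α,M}(γ)`: the maximal achievable relevance at Rényi entropy cost `γ`. -/
def Irel {Y X : Type} [Fintype Y] [Fintype X]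
    (p : Y → X → ℝ) (M : ℕ) (α γ : ℝ) : ℝ :=
  sSup {η | (γ, η) ∈ Region p M α}


lemma shEnt_marginal_le_shEnt {A B : Type} [Fintype A] [Fintype B] (r : A → B → ℝ)
    (hr : ∀ a b, 0 ≤ r a b) :
    shEnt (fun a => ∑ b, r a b) ≤ shEnt (fun ab : A × B => r ab.1 ab.2) := by
  unfold shEnt
  rw [neg_le_neg_iff, Fintype.sum_prod_type]
  refine Finset.sum_le_sum fun a _ => ?_
  rw [Finset.sum_mul]
  refine Finset.sum_le_sum fun b _ => ?_
  rcases (hr a b).eq_or_lt with h | h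
  · simp [← h]
  · refine mul_le_mul_of_nonneg_left ?_ h.le
    exact Real.logb_le_logb_of_le one_lt_two h
      (Finset.single_le_sum (f := fun b => r a b) (fun b _ => hr a b) (Finset.mem_univ b))

lemma mi2_le_shEnt_snd {A B : Type} [Fintype A] [Fintype B] (r : A → B → ℝ)
    (hr : ∀ a b, 0 ≤ r a b) : mi2 r ≤ shEnt (fun b => ∑ a, r a b) := by
  have := shEnt_marginal_le_shEnt r hr
  unfold mi2
  linarith

lemma shEnt_nonneg {I : Type} [Fintype I] (P : I → ℝ) (h0 : ∀ i, 0 ≤ P i) (h1 : ∑ i, P i = 1) :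
    0 ≤ shEnt P := by
  unfold shEnt
  rw [neg_nonneg]
  refine Finset.sum_nonpos fun i _ => mul_nonpos_of_nonneg_of_nonpos (h0 i) ?_
  refine Real.logb_nonpos one_lt_two (h0 i) ?_
  rw [← h1]
  exact Finset.single_le_sum (fun i _ => h0 i) (Finset.mem_univ i)

lemma shEnt_le_renyiEnt {I : Type} [Fintype I] (P : I → ℝ) (h0 : ∀ i, 0 ≤ P i)
    (h1 : ∑ i, P i = 1) {α : ℝ} (hα0 : 0 < α) (hα1 : α < 1) : shEnt P ≤ renyiEnt α P := by
  set S := ∑ i, P i ^ α with hS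
  have hSpos : 0 < S := by
    have hne : ∑ i, P i ≠ 0 := by rw [h1]; exact one_ne_zero
    obtain ⟨i, _, hi⟩ := Finset.exists_ne_zero_of_sum_ne_zero hne
    have hi' : 0 < P i := lt_of_le_of_ne (h0 i) (Ne.symm hi)
    exact Finset.sum_pos' (fun j _ => Real.rpow_nonneg (h0 j) α)
      ⟨i, Finset.mem_univ i, Real.rpow_pos_of_pos hi' α⟩
  have key : ∀ i, P i * ((α - 1) * Real.log (P i)) - P i * Real.log S ≤ P i ^ α / S - P i := by
    intro i
    rcases (h0 i).eq_or_lt with h | h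
    · simp [← h, Real.zero_rpow hα0.ne']
    · have hpos : 0 < P i ^ (α - 1) / S := div_pos (Real.rpow_pos_of_pos h _) hSpos
      have hlog := Real.log_le_sub_one_of_pos hpos
      rw [Real.log_div (Real.rpow_pos_of_pos h _).ne' hSpos.ne', Real.log_rpow h] at hlog
      have hm := mul_le_mul_of_nonneg_left hlog h.le
      have hrp : P i ^ α = P i * P i ^ (α - 1) := by
        rw [Real.rpow_sub_one h.ne']; field_simp
      rw [hrp]
      calc _ = P i * ((α - 1) * Real.log (P i) - Real.log S) := by ring
        _ ≤ _ := hm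
        _ = _ := by ring
  have hsum := Finset.sum_le_sum fun i (_ : i ∈ Finset.univ) => key i
  rw [Finset.sum_sub_distrib, Finset.sum_sub_distrib, ← Finset.sum_div, ← hS, div_self hSpos.ne',
    ← Finset.sum_mul, h1] at hsum
  have hrw : ∑ i, P i * ((α - 1) * Real.log (P i)) = (1 - α) * (-∑ i, P i * Real.log (P i)) := by
    rw [← Finset.sum_neg_distrib, Finset.mul_sum]
    exact Finset.sum_congr rfl fun i _ => by ring
  rw [hrw] at hsum
  have hlog2 : 0 < Real.log 2 := Real.log_pos one_lt_two
  unfold shEnt renyiEnt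
  rw [← hS, inv_mul_eq_div, le_div_iff₀ (by linarith)]
  simp only [Real.logb, ← mul_div_assoc]
  rw [← Finset.sum_div, ← neg_div, div_mul_eq_mul_div]
  gcongr
  linarith

lemma renyiEnt_le_of_pmf {I : Type} [Fintype I] (P : I → ℝ) (h0 : ∀ i, 0 ≤ P i)
    (h1 : ∑ i, P i = 1) {α : ℝ} (hα0 : 0 < α) (hα1 : α < 1) :
    renyiEnt α P ≤ (1 - α)⁻¹ * (Fintype.card I : ℝ) / Real.log 2 := by
  have hle : ∑ i, P i ^ α ≤ (Fintype.card I : ℝ) := by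
    calc ∑ i, P i ^ α ≤ ∑ _i : I, (1 : ℝ) := by
          refine Finset.sum_le_sum fun i _ => Real.rpow_le_one (h0 i) ?_ hα0.le
          rw [← h1]
          exact Finset.single_le_sum (fun i _ => h0 i) (Finset.mem_univ i)
      _ = _ := by simp
  have hlog2 : 0 < Real.log 2 := Real.log_pos one_lt_two
  have hα : 0 < 1 - α := by linarith
  unfold renyiEnt Real.logb
  rw [← mul_div_assoc]
  gcongr
  exact (Real.log_le_self (Finset.sum_nonneg fun i _ => Real.rpow_nonneg (h0 i) α)).trans hle

lemma le_env {F : ℝ → ℝ} (hF : ∀ x, 0 ≤ x → F x ≤ x) {t x y γ : ℝ} (ht0 : 0 ≤ t) (ht1 : t ≤ 1)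
    (hx : 0 ≤ x) (hy : 0 ≤ y) (h : t * x + (1 - t) * y = γ) :
    t * F x + (1 - t) * F y ≤ env F γ := by
  refine le_csSup ⟨γ, ?_⟩ ⟨t, x, y, ht0, ht1, hx, hy, h, rfl⟩
  rintro v ⟨s, a, b, hs0, hs1, ha, hb, hab, rfl⟩
  rw [← hab]
  have := sub_nonneg.2 hs1
  have := hF a ha
  have := hF b hb
  gcongr

/-- The two-point concave envelope admits a nondecreasing affine majorant of `F` touching it. -/
lemma exists_support_env {F : ℝ → ℝ} (hF : ∀ x, 0 ≤ x → F x ≤ x) (hF0 : ∀ x, 0 ≤ x → 0 ≤ F x)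
    (hmono : ∀ x y, 0 ≤ x → x ≤ y → F x ≤ F y) {γ : ℝ} (hγ : 0 ≤ γ) :
    ∃ l, 0 ≤ l ∧ ∀ x, 0 ≤ x → F x ≤ env F γ + l * (x - γ) := by
  have hself : F γ ≤ env F γ := by
    have := le_env hF zero_le_one le_rfl hγ hγ (γ := γ) (by ring)
    linarith
  rcases hγ.eq_or_lt with rfl | hpos
  · refine ⟨1, zero_le_one, fun x hx => ?_⟩
    linarith [hF x hx, hF0 0 le_rfl]
  set E := env F γ with hE
  set S : Set ℝ := insert 0 {s | ∃ x, γ < x ∧ s = (F x - E) / (x - γ)} with hS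
  have hub : ∀ x, 0 ≤ x → x < γ → ∀ s ∈ S, s ≤ (E - F x) / (γ - x) := by
    rintro x hx hxγ s (rfl | ⟨y, hy, rfl⟩)
    · have := hmono x γ hx hxγ.le
      exact div_nonneg (by linarith) (by linarith)
    · have hyx : 0 < y - x := by linarith
      have h := le_env hF (t := (y - γ) / (y - x)) (x := x) (y := y) (γ := γ)
        (div_nonneg (by linarith) hyx.le) ((div_le_one hyx).2 (by linarith)) hx (by linarith)
        (by field_simp; ring)
      rw [← hE] at h
      have h2 : (y - γ) * F x + (γ - x) * F y ≤ E * (y - x) := by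
        have h3 := mul_le_mul_of_nonneg_right h hyx.le
        have h4 : ((y - γ) / (y - x) * F x + (1 - (y - γ) / (y - x)) * F y) * (y - x)
            = (y - γ) * F x + (γ - x) * F y := by field_simp; ring
        rwa [h4] at h3
      rw [div_le_div_iff₀ (by linarith) (by linarith)]
      nlinarith
  have hbdd : BddAbove S := ⟨_, hub 0 le_rfl hpos⟩
  refine ⟨sSup S, le_csSup hbdd (Set.mem_insert _ _), fun x hx => ?_⟩
  rcases lt_trichotomy x γ with h | rfl | h
  · have hle : sSup S ≤ (E - F x) / (γ - x) := csSup_le (Set.insert_nonempty _ _) (hub x hx h)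
    rw [le_div_iff₀ (by linarith)] at hle
    linarith
  · simpa using hself
  · have hle : (F x - E) / (x - γ) ≤ sSup S := le_csSup hbdd (Set.mem_insert_of_mem _ ⟨x, h, rfl⟩)
    rw [div_le_iff₀ (by linarith)] at hle
    linarith

section Channels

variable {Y X W : Type} [Fintype Y] [Fintype X] [Fintype W]

lemma jointYW_nonneg {p : Y → X → ℝ} {q : X → W → ℝ} (hp : IsJointPmf p) (hq : IsKernel q)
    (y : Y) (w : W) : 0 ≤ jointYW p q y w :=
  Finset.sum_nonneg fun x _ => mul_nonneg (hp.1 y x) (hq.1 x w)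

lemma sum_jointYW (p : Y → X → ℝ) (q : X → W → ℝ) (w : W) :
    ∑ y, jointYW p q y w = margW p q w := by
  unfold jointYW margW margX
  rw [Finset.sum_comm]
  exact Finset.sum_congr rfl fun x _ => (Finset.sum_mul _ _ _).symm

lemma margX_nonneg {p : Y → X → ℝ} (hp : IsJointPmf p) (x : X) : 0 ≤ margX p x :=
  Finset.sum_nonneg fun y _ => hp.1 y x

lemma sum_margX {p : Y → X → ℝ} (hp : IsJointPmf p) : ∑ x, margX p x = 1 := by
  rw [← hp.2, Finset.sum_comm]
  rfl

lemma margW_nonneg {p : Y → X → ℝ} {q : X → W → ℝ} (hp : IsJointPmf p) (hq : IsKernel q)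
    (w : W) : 0 ≤ margW p q w :=
  Finset.sum_nonneg fun x _ => mul_nonneg (margX_nonneg hp x) (hq.1 x w)

lemma sum_margW {p : Y → X → ℝ} {q : X → W → ℝ} (hp : IsJointPmf p) (hq : IsKernel q) :
    ∑ w, margW p q w = 1 := by
  unfold margW
  rw [Finset.sum_comm, ← sum_margX hp]
  exact Finset.sum_congr rfl fun x _ => by rw [← Finset.mul_sum, hq.2, mul_one]

lemma miYW_le_renyiEnt {p : Y → X → ℝ} {q : X → W → ℝ} (hp : IsJointPmf p) (hq : IsKernel q)
    {α : ℝ} (hα0 : 0 < α) (hα1 : α < 1) : miYW p q ≤ renyiEnt α (margW p q) := by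
  have h := mi2_le_shEnt_snd _ (jointYW_nonneg hp hq)
  simp only [sum_jointYW] at h
  exact h.trans (shEnt_le_renyiEnt _ (margW_nonneg hp hq) (sum_margW hp hq) hα0 hα1)

lemma renyiEnt_margW_nonneg {p : Y → X → ℝ} {q : X → W → ℝ} (hp : IsJointPmf p)
    (hq : IsKernel q) {α : ℝ} (hα0 : 0 < α) (hα1 : α < 1) : 0 ≤ renyiEnt α (margW p q) :=
  (shEnt_nonneg _ (margW_nonneg hp hq) (sum_margW hp hq)).trans
    (shEnt_le_renyiEnt _ (margW_nonneg hp hq) (sum_margW hp hq) hα0 hα1)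

lemma exists_trivial_kernel {p : Y → X → ℝ} (hp : IsJointPmf p) [DecidableEq W] (w₀ : W)
    {α : ℝ} (hα0 : 0 < α) :
    ∃ q : X → W → ℝ, IsKernel q ∧ renyiEnt α (margW p q) = 0 ∧ miYW p q = 0 := by
  refine ⟨fun _ w => if w = w₀ then 1 else 0, ⟨fun x w => by positivity, fun x => by simp⟩, ?_, ?_⟩
  · have h : ∀ w, (margW p fun _ w => if w = w₀ then (1 : ℝ) else 0) w
        = if w = w₀ then 1 else 0 := by
      intro w
      unfold margW
      rw [← Finset.sum_mul, sum_margX hp, one_mul]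
    have h2 : ∀ w, (if w = w₀ then (1 : ℝ) else 0) ^ α = if w = w₀ then 1 else 0 := by
      intro w; split_ifs <;> simp [Real.zero_rpow hα0.ne']
    simp [renyiEnt, h, h2]
  · have hj : ∀ y w, (jointYW p fun _ w => if w = w₀ then (1 : ℝ) else 0) y w
        = if w = w₀ then margY p y else 0 := by
      intro y w
      unfold jointYW margY
      by_cases hw : w = w₀ <;> simp [hw]
    have hY : ∑ y, margY p y = 1 := hp.2
    have hw : ∀ w, ∑ y, (if w = w₀ then margY p y else 0) = if w = w₀ then 1 else 0 := by
      intro w; split_ifs <;> simp [hY]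
    unfold miYW mi2 shEnt
    simp only [hj, hw, Fintype.sum_prod_type]
    simp [ite_mul]

section Bottleneck

variable {p : Y → X → ℝ} {M : ℕ} {α : ℝ}

lemma bddAbove_miYW (hp : IsJointPmf p) (hα0 : 0 < α) (hα1 : α < 1) (x : ℝ) :
    x ∈ upperBounds {v | ∃ q : X → Fin M → ℝ, IsKernel q ∧ entOrd α (margW p q) ≤ x ∧
      v = miYW p q} := by
  rintro v ⟨q, hq, hx, rfl⟩
  rw [entOrd, if_neg hα1.ne] at hx
  exact (miYW_le_renyiEnt hp hq hα0 hα1).trans hx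

lemma miYW_le_Ffun (hp : IsJointPmf p) (hα0 : 0 < α) (hα1 : α < 1) {q : X → Fin M → ℝ}
    (hq : IsKernel q) {x : ℝ} (hx : renyiEnt α (margW p q) ≤ x) : miYW p q ≤ Ffun p M α x :=
  le_csSup ⟨x, bddAbove_miYW hp hα0 hα1 x⟩ ⟨q, hq, by rwa [entOrd, if_neg hα1.ne], rfl⟩

lemma Ffun_le {x : ℝ} (hp : IsJointPmf p) (hM : 0 < M) (hα0 : 0 < α) (hα1 : α < 1) (hx : 0 ≤ x)
    {c : ℝ} (h : ∀ q : X → Fin M → ℝ, IsKernel q → renyiEnt α (margW p q) ≤ x → miYW p q ≤ c) :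
    Ffun p M α x ≤ c := by
  obtain ⟨q, hq, hq0, -⟩ := exists_trivial_kernel hp (⟨0, hM⟩ : Fin M) hα0
  refine csSup_le ⟨_, q, hq, by rw [entOrd, if_neg hα1.ne, hq0]; exact hx, rfl⟩ ?_
  rintro v ⟨q', hq', hx', rfl⟩
  rw [entOrd, if_neg hα1.ne] at hx'
  exact h q' hq' hx'

lemma Ffun_le_self (hp : IsJointPmf p) (hM : 0 < M) (hα0 : 0 < α) (hα1 : α < 1) (x : ℝ)
    (hx : 0 ≤ x) : Ffun p M α x ≤ x :=
  Ffun_le hp hM hα0 hα1 hx fun _ hq h => (miYW_le_renyiEnt hp hq hα0 hα1).trans h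

lemma Ffun_nonneg (hp : IsJointPmf p) (hM : 0 < M) (hα0 : 0 < α) (hα1 : α < 1) (x : ℝ)
    (hx : 0 ≤ x) : 0 ≤ Ffun p M α x := by
  obtain ⟨q, hq, hq0, hq1⟩ := exists_trivial_kernel hp (⟨0, hM⟩ : Fin M) hα0
  exact hq1.symm.le.trans (miYW_le_Ffun hp hα0 hα1 hq (hq0.trans_le hx))

lemma Ffun_mono (hp : IsJointPmf p) (hM : 0 < M) (hα0 : 0 < α) (hα1 : α < 1) (x y : ℝ)
    (hx : 0 ≤ x) (hxy : x ≤ y) : Ffun p M α x ≤ Ffun p M α y :=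
  Ffun_le hp hM hα0 hα1 hx fun _ hq h => miYW_le_Ffun hp hα0 hα1 hq (h.trans hxy)

end Bottleneck

section Codes

open Classical in
lemma sum_pi_prod_mul_ite {n : ℕ} {B : Type} [Fintype B] (g : Fin n → B → ℝ) (i : Fin n) (b : B) :
    ∑ f : Fin n → B, (∏ j, g j (f j)) * (if f i = b then 1 else 0)
      = g i b * ∏ j ∈ Finset.univ.erase i, ∑ b', g j b' := by
  have h1 : ∀ f : Fin n → B, (∏ j, g j (f j)) * (if f i = b then 1 else 0)
      = ∏ j, (if j = i then (if f j = b then g j (f j) else 0) else g j (f j)) := by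
    intro f
    rw [← Finset.mul_prod_erase _ _ (Finset.mem_univ i),
      ← Finset.mul_prod_erase Finset.univ
        (fun j => if j = i then (if f j = b then g j (f j) else 0) else g j (f j))
        (Finset.mem_univ i)]
    have h2 : ∏ j ∈ Finset.univ.erase i,
        (if j = i then (if f j = b then g j (f j) else 0) else g j (f j))
          = ∏ j ∈ Finset.univ.erase i, g j (f j) :=
      Finset.prod_congr rfl fun j hj => if_neg (Finset.ne_of_mem_erase hj)
    rw [h2]
    by_cases hb : f i = b <;> simp [hb]
  simp only [h1]
  have h3 := Finset.prod_univ_sum (fun _ : Fin n => (Finset.univ : Finset B))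
    (fun j b' => if j = i then (if b' = b then g j b' else 0) else g j b')
  rw [Fintype.piFinset_univ] at h3
  rw [← h3, ← Finset.mul_prod_erase _ _ (Finset.mem_univ i)]
  congr 1
  · simp
  · exact Finset.prod_congr rfl fun j hj => by simp [Finset.ne_of_mem_erase hj]

open Classical in
/-- The channel from `X_i` to `W_i` induced by a code. -/
def codeChannel (p : Y → X → ℝ) (n : ℕ) (Q : (Fin n → X) → (Fin n → W) → ℝ) (i : Fin n)
    (x : X) (w : W) : ℝ :=
  ∑ xn : Fin n → X, (∏ j ∈ Finset.univ.erase i, margX p (xn j)) * (if xn i = x then 1 else 0) *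
    ∑ wn : Fin n → W, Q xn wn * (if wn i = w then 1 else 0)

open Classical in
lemma sum_prod_erase_margX {p : Y → X → ℝ} (hp : IsJointPmf p) (n : ℕ) (i : Fin n) (x : X) :
    ∑ xn : Fin n → X, (∏ j ∈ Finset.univ.erase i, margX p (xn j)) *
      (if xn i = x then (1 : ℝ) else 0) = 1 := by
  have h := sum_pi_prod_mul_ite (fun j b => if j = i then 1 else margX p b) i x
  have h1 : ∀ xn : Fin n → X, ∏ j, (if j = i then 1 else margX p (xn j))
      = ∏ j ∈ Finset.univ.erase i, margX p (xn j) := by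
    intro xn
    rw [← Finset.mul_prod_erase _ _ (Finset.mem_univ i)]
    simp only [if_true, one_mul]
    exact Finset.prod_congr rfl fun j hj => if_neg (Finset.ne_of_mem_erase hj)
  simp only [h1] at h
  rw [h]
  simp only [if_true, one_mul]
  refine Finset.prod_eq_one fun j hj => ?_
  simp [Finset.ne_of_mem_erase hj, sum_margX hp]

lemma isKernel_codeChannel {p : Y → X → ℝ} (hp : IsJointPmf p) {n : ℕ}
    {Q : (Fin n → X) → (Fin n → W) → ℝ} (hQ : IsKernel Q) (i : Fin n) :
    IsKernel (codeChannel p n Q i) := by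
  classical
  refine ⟨fun x w => ?_, fun x => ?_⟩
  · refine Finset.sum_nonneg fun xn _ => mul_nonneg (mul_nonneg ?_ (by positivity)) ?_
    · exact Finset.prod_nonneg fun j _ => margX_nonneg hp _
    · exact Finset.sum_nonneg fun wn _ => mul_nonneg (hQ.1 _ _) (by positivity)
  · unfold codeChannel
    rw [Finset.sum_comm]
    refine (Finset.sum_congr rfl fun xn _ => ?_).trans (sum_prod_erase_margX hp n i x)
    rw [← Finset.mul_sum, Finset.sum_comm]
    simp only [← Finset.mul_sum, Finset.sum_ite_eq, Finset.mem_univ, if_true, mul_one, hQ.2]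

lemma pairYW_eq_jointYW (p : Y → X → ℝ) (n : ℕ) (Q : (Fin n → X) → (Fin n → W) → ℝ)
    (i : Fin n) : pairYW p n Q i = jointYW p (codeChannel p n Q i) := by
  classical
  funext y w
  unfold pairYW jointYW codeChannel
  simp only [Finset.mul_sum (Finset.univ : Finset (Fin n → X))]
  rw [Finset.sum_comm]
  conv_rhs => rw [Finset.sum_comm]
  refine Finset.sum_congr rfl fun xn _ => ?_
  have h1 : ∀ yn : Fin n → Y, ∑ wn : Fin n → W, iidP p n yn xn * Q xn wn *
      (if yn i = y ∧ wn i = w then 1 else 0)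
      = ((∏ j, p (yn j) (xn j)) * (if yn i = y then 1 else 0)) *
        ∑ wn : Fin n → W, Q xn wn * (if wn i = w then 1 else 0) := by
    intro yn
    rw [Finset.mul_sum]
    refine Finset.sum_congr rfl fun wn _ => ?_
    unfold iidP
    by_cases hy : yn i = y <;> by_cases hw : wn i = w <;> simp [hy, hw]
  simp only [h1]
  rw [← Finset.sum_mul, sum_pi_prod_mul_ite (fun j b => p b (xn j)) i y,
    Finset.sum_eq_single (xn i)]
  · simp only [if_true, mul_one, Finset.mul_sum, mul_assoc]
    rfl
  · intro x _ hx
    simp [hx.symm]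
  · simp

/-- The memoryless code using channel `q j` at time `j`. -/
def productCode {n : ℕ} (q : Fin n → X → W → ℝ) (xn : Fin n → X) (wn : Fin n → W) : ℝ :=
  ∏ j, q j (xn j) (wn j)

lemma isKernel_productCode {n : ℕ} {q : Fin n → X → W → ℝ} (hq : ∀ j, IsKernel (q j)) :
    IsKernel (productCode q) := by
  classical
  refine ⟨fun xn wn => Finset.prod_nonneg fun j _ => (hq j).1 _ _, fun xn => ?_⟩
  have h := Finset.prod_univ_sum (fun _ : Fin n => (Finset.univ : Finset W))
    (fun j w => q j (xn j) w)
  rw [Fintype.piFinset_univ] at h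
  exact h.symm.trans (Finset.prod_eq_one fun j _ => (hq j).2 _)

lemma codeChannel_productCode {p : Y → X → ℝ} (hp : IsJointPmf p) {n : ℕ}
    {q : Fin n → X → W → ℝ} (hq : ∀ j, IsKernel (q j)) (i : Fin n) :
    codeChannel p n (productCode q) i = q i := by
  classical
  funext x w
  unfold codeChannel productCode
  have h : ∀ xn : Fin n → X, ∑ wn : Fin n → W, (∏ j, q j (xn j) (wn j)) *
      (if wn i = w then 1 else 0) = q i (xn i) w := by
    intro xn
    rw [sum_pi_prod_mul_ite (fun j b => q j (xn j) b) i w,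
      Finset.prod_eq_one fun j _ => (hq j).2 (xn j), mul_one]
  simp only [h]
  have h1 := congrArg (· * q i x w) (sum_prod_erase_margX hp n i x)
  simp only [Finset.sum_mul, one_mul] at h1
  refine (Finset.sum_congr rfl fun xn _ => ?_).trans h1
  by_cases hx : xn i = x <;> simp [hx]

lemma avgRenyi_eq (p : Y → X → ℝ) (n : ℕ) (Q : (Fin n → X) → (Fin n → W) → ℝ) (α : ℝ) :
    avgRenyi p n Q α
      = (1 / (n : ℝ)) * ∑ i, renyiEnt α (margW p (codeChannel p n Q i)) := by
  unfold avgRenyi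
  simp only [pairYW_eq_jointYW, sum_jointYW]

lemma avgRel_eq (p : Y → X → ℝ) (n : ℕ) (Q : (Fin n → X) → (Fin n → W) → ℝ) :
    avgRel p n Q = (1 / (n : ℝ)) * ∑ i, miYW p (codeChannel p n Q i) := by
  unfold avgRel
  simp only [pairYW_eq_jointYW]
  rfl

end Codes

end Channels

/-- Averages of a two-valued sequence with switching time `⌊t n⌋` converge. -/
lemma tendsto_avg_switch {t : ℝ} (ht0 : 0 ≤ t) (ht1 : t ≤ 1) (a b : ℝ) :
    Tendsto (fun n : ℕ => (1 / (n : ℝ)) * ∑ i : Fin n, if (i : ℕ) < ⌊t * n⌋₊ then a else b) atTop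
      (nhds (t * a + (1 - t) * b)) := by
  have hk : Tendsto (fun n : ℕ => (⌊t * n⌋₊ : ℝ) / n) atTop (nhds t) :=
    (tendsto_nat_floor_mul_div_atTop ht0).comp tendsto_natCast_atTop_atTop
  refine ((hk.mul_const a).add ((hk.const_sub 1).mul_const b)).congr' ?_
  filter_upwards [eventually_gt_atTop 0] with n hn
  have hn' : (0 : ℝ) < n := Nat.cast_pos.2 hn
  have hle : ⌊t * n⌋₊ ≤ n := by
    refine Nat.floor_le_of_le ?_
    nlinarith
  rw [Fin.sum_univ_eq_sum_range (fun i => if i < ⌊t * n⌋₊ then a else b) n]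
  obtain ⟨m, hm⟩ := Nat.exists_eq_add_of_le hle
  generalize ⌊t * n⌋₊ = k at *
  subst hm
  rw [Finset.sum_range_add]
  have h1 : ∑ i ∈ Finset.range k, (if i < k then a else b) = k * a := by
    rw [Finset.sum_congr rfl fun i hi => if_pos (Finset.mem_range.1 hi)]
    simp
  rw [h1]
  simp
  push_cast at hn'
  field_simp
  ring

section Region

variable {Y X : Type} [Fintype Y] [Fintype X] {p : Y → X → ℝ} {M : ℕ} {α γ : ℝ}

lemma achievable_timeSharing (hp : IsJointPmf p) {q₁ q₂ : X → Fin M → ℝ} (hq₁ : IsKernel q₁)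
    (hq₂ : IsKernel q₂) {t : ℝ} (ht0 : 0 ≤ t) (ht1 : t ≤ 1)
    (hγ : t * renyiEnt α (margW p q₁) + (1 - t) * renyiEnt α (margW p q₂) ≤ γ) :
    Achievable p M α γ (t * miYW p q₁ + (1 - t) * miYW p q₂) := by
  have hq : ∀ n : ℕ, ∀ j : Fin n, IsKernel (if (j : ℕ) < ⌊t * n⌋₊ then q₁ else q₂) := by
    intro n j
    split_ifs <;> assumption
  refine ⟨fun n => productCode fun j : Fin n => if (j : ℕ) < ⌊t * n⌋₊ then q₁ else q₂,
    fun n => isKernel_productCode (hq n), ?_, ?_⟩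
  · simp only [avgRenyi_eq, codeChannel_productCode hp (hq _),
      apply_ite (fun q => renyiEnt α (margW p q))]
    rwa [(tendsto_avg_switch ht0 ht1 _ _).limsup_eq]
  · simp only [avgRel_eq, codeChannel_productCode hp (hq _), apply_ite (fun q => miYW p q)]
    rw [(tendsto_avg_switch ht0 ht1 _ _).liminf_eq]

lemma le_affine_of_achievable (hp : IsJointPmf p) (hα0 : 0 < α) (hα1 : α < 1)
    {c l : ℝ} (hl : 0 ≤ l)
    (hq : ∀ q : X → Fin M → ℝ, IsKernel q → miYW p q ≤ c + l * renyiEnt α (margW p q))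
    {η : ℝ} (hc : 0 ≤ c + l * γ) (h : Achievable p M α γ η) : η ≤ c + l * γ := by
  obtain ⟨Q, hQ, hsup, hinf⟩ := h
  refine hinf.trans ?_
  rw [Filter.liminf_eq]
  refine Real.sSup_le (fun a ha => ?_) hc
  have hbound : ∀ᶠ n in atTop, avgRel p n (Q n) ≤ c + l * avgRenyi p n (Q n) α := by
    filter_upwards [eventually_gt_atTop 0] with n hn
    have hn' : (0 : ℝ) < n := Nat.cast_pos.2 hn
    rw [avgRel_eq, avgRenyi_eq]
    have hs := Finset.sum_le_sum fun i (_ : i ∈ Finset.univ) =>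
      hq _ (isKernel_codeChannel hp (hQ n) i)
    rw [Finset.sum_add_distrib, ← Finset.mul_sum] at hs
    simp only [Finset.sum_const, Finset.card_univ, Fintype.card_fin, nsmul_eq_mul] at hs
    calc _ ≤ _ := mul_le_mul_of_nonneg_left hs (by positivity)
      _ = _ := by field_simp
  have hbdd : IsBoundedUnder (· ≤ ·) atTop fun n => avgRenyi p n (Q n) α := by
    refine ⟨(1 - α)⁻¹ * (Fintype.card (Fin M) : ℝ) / Real.log 2, ?_⟩
    rw [eventually_map]
    filter_upwards [eventually_gt_atTop 0] with n hn
    have hn' : (0 : ℝ) < n := Nat.cast_pos.2 hn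
    rw [avgRenyi_eq]
    have hs := Finset.sum_le_sum fun i (_ : i ∈ Finset.univ) =>
      renyiEnt_le_of_pmf _ (margW_nonneg hp (isKernel_codeChannel hp (hQ n) i))
        (sum_margW hp (isKernel_codeChannel hp (hQ n) i)) hα0 hα1
    rw [Finset.sum_const, Finset.card_univ, Fintype.card_fin, nsmul_eq_mul] at hs
    rw [one_div, inv_mul_le_iff₀ hn']
    exact hs
  have hε : ∀ ε > 0, a ≤ c + l * (γ + ε) := by
    intro ε hε
    have hlt := eventually_lt_of_limsup_lt (hsup.trans_lt (lt_add_of_pos_right γ hε)) hbdd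
    obtain ⟨n, h1, h2, h3⟩ := (hlt.and (hbound.and ha)).exists
    have := mul_le_mul_of_nonneg_left h1.le hl
    linarith
  have hcont : Tendsto (fun ε : ℝ => c + l * (γ + ε)) (nhdsWithin 0 (Set.Ioi 0))
      (nhds (c + l * (γ + 0))) :=
    (Continuous.tendsto (by fun_prop) 0).mono_left nhdsWithin_le_nhds
  rw [add_zero] at hcont
  exact ge_of_tendsto hcont (eventually_nhdsWithin_of_forall hε)

lemma le_env_of_mem_region (hp : IsJointPmf p) (hM : 0 < M) (hα0 : 0 < α) (hα1 : α < 1)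
    (hγ : 0 ≤ γ) {η : ℝ} (h : (γ, η) ∈ Region p M α) : η ≤ env (Ffun p M α) γ := by
  obtain ⟨l, hl, hsupp⟩ := exists_support_env (Ffun_le_self hp hM hα0 hα1)
    (Ffun_nonneg hp hM hα0 hα1) (Ffun_mono hp hM hα0 hα1) hγ
  have hclosed : IsClosed {z : ℝ × ℝ | z.2 ≤ env (Ffun p M α) γ + l * (z.1 - γ)} :=
    isClosed_le (by fun_prop) (by fun_prop)
  have hsub : Region p M α ⊆ {z : ℝ × ℝ | z.2 ≤ env (Ffun p M α) γ + l * (z.1 - γ)} := by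
    refine closure_minimal ?_ hclosed
    rintro ⟨a, b⟩ ⟨ha, -, hab⟩
    have hb := le_affine_of_achievable hp hα0 hα1 (c := env (Ffun p M α) γ - l * γ) hl ?_ ?_ hab
    · simp only [Set.mem_ofPred_eq]
      linarith
    · intro q hq
      linarith [miYW_le_Ffun hp hα0 hα1 hq le_rfl,
        hsupp _ (renyiEnt_margW_nonneg hp hq hα0 hα1)]
    · linarith [hsupp a ha, Ffun_nonneg hp hM hα0 hα1 a ha]
  simpa using hsub h

lemma timeSharing_le_Irel (hp : IsJointPmf p) (hM : 0 < M) (hα0 : 0 < α) (hα1 : α < 1)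
    (hγ : 0 ≤ γ) {q₁ q₂ : X → Fin M → ℝ} (hq₁ : IsKernel q₁) (hq₂ : IsKernel q₂)
    {t : ℝ} (ht0 : 0 ≤ t) (ht1 : t ≤ 1)
    (h : t * renyiEnt α (margW p q₁) + (1 - t) * renyiEnt α (margW p q₂) ≤ γ) :
    t * miYW p q₁ + (1 - t) * miYW p q₂ ≤ Irel p M α γ := by
  have hle : ∀ η, 0 ≤ η → Achievable p M α γ η → η ≤ Irel p M α γ := fun η hη hach =>
    le_csSup ⟨_, fun _ => le_env_of_mem_region hp hM hα0 hα1 hγ⟩ (subset_closure ⟨hγ, hη, hach⟩)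
  obtain ⟨q, hq, hq0, hq1⟩ := exists_trivial_kernel hp (⟨0, hM⟩ : Fin M) hα0
  have h0 : 0 ≤ Irel p M α γ := by
    have := achievable_timeSharing (M := M) (α := α) (γ := γ) hp hq hq ht0 ht1 (by simpa [hq0])
    exact hle 0 le_rfl (by simpa [hq1] using this)
  rcases le_total 0 (t * miYW p q₁ + (1 - t) * miYW p q₂) with hv | hv
  · exact hle _ hv (achievable_timeSharing hp hq₁ hq₂ ht0 ht1 h)
  · exact hv.trans h0

lemma exists_miYW_gt_Ffun_sub (hp : IsJointPmf p) (hM : 0 < M) (hα0 : 0 < α) (hα1 : α < 1)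
    {x ε : ℝ} (hx : 0 ≤ x) (hε : 0 < ε) :
    ∃ q : X → Fin M → ℝ, IsKernel q ∧ renyiEnt α (margW p q) ≤ x ∧
      Ffun p M α x - ε < miYW p q := by
  by_contra! hcon
  linarith [Ffun_le hp hM hα0 hα1 hx hcon]

lemma env_le_Irel (hp : IsJointPmf p) (hM : 0 < M) (hα0 : 0 < α) (hα1 : α < 1)
    (hγ : 0 ≤ γ) : env (Ffun p M α) γ ≤ Irel p M α γ := by
  refine csSup_le ⟨_, 1, γ, γ, zero_le_one, le_rfl, hγ, hγ, by ring, rfl⟩ ?_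
  rintro v ⟨t, x, y, ht0, ht1, hx, hy, hxy, rfl⟩
  refine le_of_forall_pos_le_add fun ε hε => ?_
  obtain ⟨q₁, hq₁, hx₁, hm₁⟩ := exists_miYW_gt_Ffun_sub hp hM hα0 hα1 hx hε
  obtain ⟨q₂, hq₂, hx₂, hm₂⟩ := exists_miYW_gt_Ffun_sub hp hM hα0 hα1 hy hε
  have ht : 0 ≤ 1 - t := sub_nonneg.2 ht1
  have hle := timeSharing_le_Irel hp hM hα0 hα1 hγ hq₁ hq₂ ht0 ht1
    (by rw [← hxy]; gcongr)
  have h1 := mul_le_mul_of_nonneg_left hm₁.le ht0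
  have h2 := mul_le_mul_of_nonneg_left hm₂.le ht
  linarith

end Region

/-- Theorem 1: for every `α ∈ (0,1)`, finite positive `M`, and `γ ≥ 0`,
`I_{α,M}(γ) = \bar I_{α,M}(γ)`. -/
theorem stmt13 {Y X : Type} [Fintype Y] [Fintype X]
    (p : Y → X → ℝ) (hp : IsJointPmf p)
    (M : ℕ) (hM : 0 < M) (α : ℝ) (hα0 : 0 < α) (hα1 : α < 1)
    (γ : ℝ) (hγ : 0 ≤ γ) :
    Irel p M α γ = env (Ffun p M α) γ := by
  have hle := env_le_Irel (γ := γ) hp hM hα0 hα1 hγ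
  refine le_antisymm (Real.sSup_le (fun η h => le_env_of_mem_region hp hM hα0 hα1 hγ h) ?_) hle
  have h := le_env (Ffun_le_self hp hM hα0 hα1) zero_le_one le_rfl hγ hγ (γ := γ) (by ring)
  linarith [Ffun_nonneg hp hM hα0 hα1 γ hγ]

end
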